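/- Fix a1, a2 > 0, real numbers δ1, δ2, and let q : [-1,1] → ℝ be continuous on [-1,0] and on [0,1]. For s ∈ ℂ with s ≠ 0 and λ = s⁴, let χ12(·,λ) be the unique solution of a2⁴u'''' + qu = λu on [0,1] with χ12(1) = -1, χ12'(1) = 0, χ12''(1) = 0, χ12'''(1) = λ, and let χ11(·,λ) be the unique solution of a1⁴u'''' + qu = λu on [-1,0] with initial data χ11(0) = χ12(0), χ11'(0) = χ12'(0), χ11''(0) = χ12''(0) + λδ1χ12'(0), χ11'''(0) = χ12'''(0) + λδ2χ12(0). Then for each k ∈ {0,1,2,3} there exist constants C > 0 and r₀ > 0 such that for all s ∈ ℂ with |s| ≥ r₀ and all x ∈ [-1,0]: |∂ₓᵏ χ11(x, s⁴)| ≤ C·|s|^{k+4}·e^{|s|(a1 − a2·x)/(a1·a2)}. -/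

import Mathlib

open Set

/-- `u` solves the fourth order equation `a^4 u'''' + q u = λ u` on `S` and is
four times continuously differentiable there. -/
def SolvesODE (a : ℝ) (q : ℝ → ℝ) (lam : ℂ) (S : Set ℝ) (u : ℝ → ℂ) : Prop :=
  ContDiffOn ℝ 4 u S ∧
  ∀ x ∈ S, (a : ℂ) ^ 4 * iteratedDerivWithin 4 u S x + (q x : ℂ) * u x = lam * u x

/-- Backward Grönwall estimate for `a ^ 4 u'''' + q u = s ^ 4 u`, for the sup norm of the rescaled
derivatives `(a / ‖s‖) ^ k u⁽ᵏ⁾`. -/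
theorem SolvesODE.norm_iteratedDerivWithin_le {a b c M N : ℝ} {q : ℝ → ℝ} {s : ℂ} {u : ℝ → ℂ}
    (ha : 0 < a) (hbc : b < c) (hs : 1 ≤ ‖s‖) (hM : ∀ x ∈ Icc b c, |q x| ≤ M)
    (hu : SolvesODE a q (s ^ 4) (Icc b c) u)
    (hN : ∀ k ≤ 3, ‖iteratedDerivWithin k u (Icc b c) c‖ * a ^ k ≤ N * ‖s‖ ^ k)
    {k : ℕ} (hk : k ≤ 3) {x : ℝ} (hx : x ∈ Icc b c) :
    ‖iteratedDerivWithin k u (Icc b c) x‖ * a ^ k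
      ≤ N * Real.exp (M / a * (c - b)) * Real.exp (‖s‖ * (c - x) / a) * ‖s‖ ^ k := by
  have hs0 : 0 < ‖s‖ := by linarith
  have hM0 : 0 ≤ M := (abs_nonneg _).trans (hM x hx)
  have hN0 : 0 ≤ N := by
    have := hN 0 (by norm_num)
    simp only [pow_zero, mul_one] at this
    exact (norm_nonneg _).trans this
  set S := Icc b c
  have hderiv : ∀ j ≤ 3, ∀ y ∈ S, HasDerivWithinAt (iteratedDerivWithin j u S)
      (iteratedDerivWithin (j + 1) u S y) S y := by
    intro j hj y hy
    rw [iteratedDerivWithin_succ]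
    exact (hu.1.differentiableOn_iteratedDerivWithin (by exact_mod_cast (by omega : j < 4))
      (uniqueDiffOn_Icc hbc) y hy).hasDerivWithinAt
  let v : ℕ → ℝ → ℂ := fun j y ↦ ((a / ‖s‖) ^ j : ℝ) • iteratedDerivWithin j u S y
  let f : ℝ → Fin 4 → ℂ := fun t j ↦ v j (c - t)
  let f' : ℝ → Fin 4 → ℂ := fun t j ↦
    -(((a / ‖s‖) ^ (j : ℕ) : ℝ) • iteratedDerivWithin (j + 1) u S (c - t))
  have hmaps : MapsTo (fun t ↦ c - t) (Icc 0 (c - b)) S := by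
    intro t ht
    exact ⟨by linarith [ht.2], by linarith [ht.1]⟩
  have hf : ∀ t ∈ Icc 0 (c - b), HasDerivWithinAt f (f' t) (Icc 0 (c - b)) t := by
    intro t ht
    rw [hasDerivWithinAt_pi]
    intro j
    have h := (hderiv j (by omega) _ (hmaps ht)).scomp t
      ((hasDerivWithinAt_id t (Icc 0 (c - b))).const_sub c) hmaps
    have h2 := h.const_smul ((a / ‖s‖) ^ (j : ℕ) : ℝ)
    simpa [f, f', v, Function.comp_def, Pi.smul_def] using h2
  have hbound : ∀ t ∈ Ico 0 (c - b), ‖f' t‖ ≤ (‖s‖ / a + M / a) * ‖f t‖ + 0 := by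
    intro t ht
    have hy := hmaps (Ico_subset_Icc_self ht)
    have hcoord : ∀ j : Fin 4, ‖v j (c - t)‖ ≤ ‖f t‖ := fun j ↦ norm_le_pi_norm (f t) j
    have hstep : ∀ j : Fin 4, ‖f' t j‖ = ‖s‖ / a * ‖v (j + 1) (c - t)‖ := by
      intro j
      simp only [f', v, norm_neg, norm_smul, norm_pow, norm_div, Real.norm_eq_abs,
        abs_of_pos ha, abs_norm]
      rw [pow_succ]
      field_simp
    have hlow : ∀ j : Fin 4, (hj : (j : ℕ) < 3) →
        ‖f' t j‖ ≤ (‖s‖ / a + M / a) * ‖f t‖ + 0 := by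
      intro j hj
      rw [hstep j]
      have := hcoord ⟨j + 1, by omega⟩
      have h3 : 0 ≤ M / a * ‖f t‖ := by positivity
      have : ‖s‖ / a * ‖v (j + 1) (c - t)‖ ≤ ‖s‖ / a * ‖f t‖ := by gcongr
      linarith
    have htop : ‖f' t 3‖ ≤ (‖s‖ / a + M / a) * ‖f t‖ + 0 := by
      have hode := hu.2 _ hy
      have h4 : a ^ 4 * ‖iteratedDerivWithin 4 u S (c - t)‖
          ≤ (‖s‖ ^ 4 + M) * ‖v 0 (c - t)‖ := by
        have h5 : (a : ℂ) ^ 4 * iteratedDerivWithin 4 u S (c - t)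
            = (s ^ 4 - (q (c - t) : ℂ)) * u (c - t) := by linear_combination hode
        have h6 := congrArg norm h5
        rw [norm_mul, norm_mul, norm_pow, Complex.norm_real, Real.norm_eq_abs,
          abs_of_pos ha] at h6
        rw [h6]
        have h7 : ‖s ^ 4 - (q (c - t) : ℂ)‖ ≤ ‖s‖ ^ 4 + M := by
          refine (norm_sub_le _ _).trans ?_
          rw [norm_pow, Complex.norm_real, Real.norm_eq_abs]
          gcongr
          exact hM _ hy
        simp only [v, pow_zero, one_smul, iteratedDerivWithin_zero]
        gcongr
      have h8 : ‖f' t 3‖ = (a ^ 4 * ‖iteratedDerivWithin 4 u S (c - t)‖) / (a * ‖s‖ ^ 3) := by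
        simp only [f', norm_neg, norm_smul, norm_pow, norm_div, Real.norm_eq_abs,
          abs_of_pos ha, abs_norm]
        simp
        field_simp
      have h9 := hcoord 0
      rw [h8, add_zero]
      calc _ ≤ (‖s‖ ^ 4 + M) * ‖v 0 (c - t)‖ / (a * ‖s‖ ^ 3) := by gcongr
        _ = (‖s‖ / a + M / (a * ‖s‖ ^ 3)) * ‖v 0 (c - t)‖ := by field_simp
        _ ≤ (‖s‖ / a + M / a) * ‖f t‖ := by
          gcongr
          · exact le_mul_of_one_le_right ha.le (one_le_pow₀ hs)
          · exact h9
    rw [pi_norm_le_iff_of_nonneg (by positivity)]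
    intro j
    rcases Nat.lt_or_ge j 3 with hj | hj
    · exact hlow j hj
    · obtain rfl : j = 3 := Fin.ext (by simp; omega)
      exact htop
  have hinit : ‖f 0‖ ≤ N := by
    rw [pi_norm_le_iff_of_nonneg hN0]
    intro j
    simp only [f, v, sub_zero, norm_smul, norm_pow, norm_div, Real.norm_eq_abs,
      abs_of_pos ha, abs_norm]
    rw [div_pow, div_mul_eq_mul_div, div_le_iff₀ (by positivity), mul_comm]
    exact hN j (by omega)
  have hgr := norm_le_gronwallBound_of_norm_deriv_right_le
    (fun t ht ↦ (hf t ht).continuousWithinAt)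
    (fun t ht ↦ (hf t (Ico_subset_Icc_self ht)).mono_of_mem_nhdsWithin
      (Icc_mem_nhdsGE_of_mem ht)) hinit hbound (c - x) ⟨by linarith [hx.2], by linarith [hx.1]⟩
  rw [gronwallBound_ε0, sub_zero] at hgr
  have hk' := (norm_le_pi_norm (f (c - x)) ⟨k, by omega⟩).trans hgr
  simp only [f, v, sub_sub_cancel, norm_smul, norm_pow, norm_div, Real.norm_eq_abs,
    abs_of_pos ha, abs_norm] at hk'
  rw [div_pow, div_mul_eq_mul_div, div_le_iff₀ (by positivity), mul_comm] at hk'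
  refine hk'.trans ?_
  rw [mul_assoc N (Real.exp (M / a * (c - b))), ← Real.exp_add]
  gcongr
  have : M / a * (c - x) ≤ M / a * (c - b) := by
    gcongr
    exact hx.1
  have e : ‖s‖ * (c - x) / a = ‖s‖ / a * (c - x) := by ring
  rw [e]
  linarith

/-- Lemma 4.3, part for `χ11`: growth of the continuation of `χ12` across `0`
via the reversed transmission conditions, and of its first three derivatives. -/
theorem chi11_asymptotic_bound
    (a1 a2 δ1 δ2 : ℝ) (ha1 : 0 < a1) (ha2 : 0 < a2) (q : ℝ → ℝ)
    (hq1 : ContinuousOn q (Icc (-1 : ℝ) 0)) (hq2 : ContinuousOn q (Icc (0 : ℝ) 1)) :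
    ∀ k : ℕ, k ≤ 3 →
      ∃ C > (0 : ℝ), ∃ r₀ > (0 : ℝ), ∀ s : ℂ, r₀ ≤ ‖s‖ →
        ∀ χ12 χ11 : ℝ → ℂ,
          SolvesODE a2 q (s ^ 4) (Icc (0 : ℝ) 1) χ12 →
          χ12 1 = -1 →
          iteratedDerivWithin 1 χ12 (Icc (0 : ℝ) 1) 1 = 0 →
          iteratedDerivWithin 2 χ12 (Icc (0 : ℝ) 1) 1 = 0 →
          iteratedDerivWithin 3 χ12 (Icc (0 : ℝ) 1) 1 = s ^ 4 →
          SolvesODE a1 q (s ^ 4) (Icc (-1 : ℝ) 0) χ11 →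
          χ11 0 = χ12 0 →
          iteratedDerivWithin 1 χ11 (Icc (-1 : ℝ) 0) 0
            = iteratedDerivWithin 1 χ12 (Icc (0 : ℝ) 1) 0 →
          iteratedDerivWithin 2 χ11 (Icc (-1 : ℝ) 0) 0
            = iteratedDerivWithin 2 χ12 (Icc (0 : ℝ) 1) 0
              + s ^ 4 * (δ1 : ℂ) * iteratedDerivWithin 1 χ12 (Icc (0 : ℝ) 1) 0 →
          iteratedDerivWithin 3 χ11 (Icc (-1 : ℝ) 0) 0
            = iteratedDerivWithin 3 χ12 (Icc (0 : ℝ) 1) 0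
              + s ^ 4 * (δ2 : ℂ) * χ12 0 →
          ∀ x ∈ Icc (-1 : ℝ) 0,
            ‖iteratedDerivWithin k χ11 (Icc (-1 : ℝ) 0) x‖
              ≤ C * ‖s‖ ^ (k + 4) * Real.exp (‖s‖ * (a1 - a2 * x) / (a1 * a2)) := by
  intro k hk
  obtain ⟨M1, hM1⟩ := isCompact_Icc.exists_bound_of_continuousOn hq1
  obtain ⟨M2, hM2⟩ := isCompact_Icc.exists_bound_of_continuousOn hq2
  let B : ℝ := 1 + a2⁻¹ + a2⁻¹ ^ 2 + a2⁻¹ ^ 3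
  let A : ℝ := 1 + a1 + a1 ^ 2 + a1 ^ 3
  let P : ℝ := (1 + a2 ^ 3) * Real.exp (M2 / a2 * (1 - 0)) * B
  let D : ℝ := 1 + |δ1| + |δ2|
  have hB : ∀ j ≤ 3, a2⁻¹ ^ j ≤ B := by
    have h : 0 < a2⁻¹ := by positivity
    intro j hj
    interval_cases j <;> simp only [B] <;> nlinarith [pow_pos h 2, pow_pos h 3]
  have hA : ∀ j ≤ 3, a1 ^ j ≤ A := by
    intro j hj
    interval_cases j <;> simp only [A] <;> nlinarith [pow_pos ha1 2, pow_pos ha1 3]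
  have hB0 : 0 < B := by positivity
  have hA0 : 0 < A := by positivity
  have hP0 : 0 < P := by positivity
  have hD0 : 0 < D := by positivity
  refine ⟨P * D * A * Real.exp (M1 / a1 * (0 - -1)) / a1 ^ k, by positivity, 1, one_pos, ?_⟩
  intro s hs χ12 χ11 hχ12 h0 h1 h2 h3 hχ11 g0 g1 g2 g3 x hx
  have hs0 : 0 < ‖s‖ := by linarith
  set E := Real.exp (‖s‖ / a2) with hE
  have hE0 : 0 < E := Real.exp_pos _
  have hright : ∀ j ≤ 3, ‖iteratedDerivWithin j χ12 (Icc 0 1) 0‖ ≤ P * E * ‖s‖ ^ (j + 1) := by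
    intro j hj
    have hN : ∀ j ≤ 3, ‖iteratedDerivWithin j χ12 (Icc 0 1) 1‖ * a2 ^ j
        ≤ ((1 + a2 ^ 3) * ‖s‖) * ‖s‖ ^ j := by
      intro j hj
      interval_cases j
      · simp only [iteratedDerivWithin_zero, h0, norm_neg, norm_one, pow_zero, mul_one]
        nlinarith [pow_pos ha2 3]
      · rw [h1, norm_zero, zero_mul]; positivity
      · rw [h2, norm_zero, zero_mul]; positivity
      · rw [h3, norm_pow]
        nlinarith [pow_pos hs0 4]
    have h := hχ12.norm_iteratedDerivWithin_le ha2 one_pos hs hM2 hN hj (x := 0) (by simp)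
    rw [← le_div_iff₀ (by positivity)] at h
    refine h.trans ?_
    calc _ = (1 + a2 ^ 3) * Real.exp (M2 / a2 * (1 - 0)) * a2⁻¹ ^ j * E * ‖s‖ ^ (j + 1) := by
          rw [sub_zero, mul_one, hE, inv_pow]; ring
      _ ≤ _ := by
        simp only [P]
        gcongr
        exact hB j hj
  have hleft : ∀ j ≤ 3, ‖iteratedDerivWithin j χ11 (Icc (-1) 0) 0‖
      ≤ P * E * D * ‖s‖ ^ 4 * ‖s‖ ^ j := by
    have hPE : 0 < P * E := by positivity
    have hpow : ∀ {m n : ℕ}, m ≤ n → ‖s‖ ^ m ≤ ‖s‖ ^ n := fun h ↦ pow_le_pow_right₀ hs h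
    have hD1 : 1 ≤ D := by simp only [D]; linarith [abs_nonneg δ1, abs_nonneg δ2]
    have hsmall : ∀ j ≤ 3, ‖iteratedDerivWithin j χ12 (Icc 0 1) 0‖
        ≤ P * E * 1 * ‖s‖ ^ (4 + j) := by
      intro j hj
      refine (hright j hj).trans ?_
      rw [mul_one]
      gcongr ?_ * ?_
      exact hpow (by omega)
    intro j hj
    rw [mul_assoc _ (‖s‖ ^ 4), ← pow_add]
    interval_cases j
    · rw [iteratedDerivWithin_zero, g0]
      refine (hsmall 0 hj).trans ?_
      gcongr
    · rw [g1]
      refine (hsmall 1 hj).trans ?_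
      gcongr
    · rw [g2]
      refine (norm_add_le _ _).trans ?_
      have e1 : ‖s ^ 4 * (δ1 : ℂ) * iteratedDerivWithin 1 χ12 (Icc 0 1) 0‖
          ≤ P * E * |δ1| * ‖s‖ ^ 6 := by
        rw [norm_mul, norm_mul, norm_pow, Complex.norm_real, Real.norm_eq_abs]
        calc _ ≤ ‖s‖ ^ 4 * |δ1| * (P * E * ‖s‖ ^ (1 + 1)) := by
              gcongr; exact hright 1 (by norm_num)
          _ = _ := by ring
      have e2 : 0 ≤ P * E * |δ2| * ‖s‖ ^ 6 := by positivity
      have := hsmall 2 hj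
      simp only [D, Nat.reduceAdd] at this ⊢
      linarith
    · rw [g3]
      refine (norm_add_le _ _).trans ?_
      have e1 : ‖s ^ 4 * (δ2 : ℂ) * χ12 0‖ ≤ P * E * |δ2| * ‖s‖ ^ 7 := by
        rw [norm_mul, norm_mul, norm_pow, Complex.norm_real, Real.norm_eq_abs]
        have h := hright 0 (by norm_num)
        rw [iteratedDerivWithin_zero] at h
        calc _ ≤ ‖s‖ ^ 4 * |δ2| * (P * E * ‖s‖ ^ (0 + 1)) := by gcongr
          _ = P * E * |δ2| * ‖s‖ ^ 5 := by ring
          _ ≤ _ := by gcongr ?_ * ?_; exact hpow (by norm_num)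
      have e2 : 0 ≤ P * E * |δ1| * ‖s‖ ^ 7 := by positivity
      have := hsmall 3 hj
      simp only [D, Nat.reduceAdd] at this ⊢
      linarith
  have hN : ∀ j ≤ 3, ‖iteratedDerivWithin j χ11 (Icc (-1) 0) 0‖ * a1 ^ j
      ≤ (P * E * D * ‖s‖ ^ 4 * A) * ‖s‖ ^ j := by
    intro j hj
    calc _ ≤ P * E * D * ‖s‖ ^ 4 * ‖s‖ ^ j * A := by
          gcongr
          · exact hleft j hj
          · exact hA j hj
      _ = _ := by ring
  have h := hχ11.norm_iteratedDerivWithin_le ha1 (by norm_num) hs hM1 hN hk hx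
  rw [← le_div_iff₀ (by positivity)] at h
  refine h.trans (le_of_eq ?_)
  have hexp : Real.exp (‖s‖ * (a1 - a2 * x) / (a1 * a2))
      = E * Real.exp (‖s‖ * (0 - x) / a1) := by
    rw [hE, ← Real.exp_add]
    congr 1
    field_simp
    ring
  rw [hexp]
  ring
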